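/- (Weighted Poincaré-type inequality on the ℓ1-sphere) Let d ≥ 3, G : ℝ^d → ℝ continuously differentiable, and ζ uniform on the ℓ1-sphere S_1^d. Then Var(G(ζ)) ≤ (4/(d(d-2))) E[||∇G(ζ)||_2^2 (1 + √d ||ζ||_2)^2]. -/

import Mathlib

open MeasureTheory ProbabilityTheory

noncomputable def laplaceMeasure : Measure ℝ :=
  volume.withDensity (fun w => ENNReal.ofReal ((1 / 2) * Real.exp (-|w|)))

/-- The uniform distribution on the ℓ¹-sphere `S₁ᵈ`, realized as the law of `W/‖W‖₁`
for `W` a vector of i.i.d. mean-0 scale-1 Laplace random variables (Schechtman–Zinn). -/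
noncomputable def sphereUniform (d : ℕ) : Measure (Fin d → ℝ) :=
  Measure.map (fun w => (∑ i, |w i|)⁻¹ • w) (Measure.pi fun _ : Fin d => laplaceMeasure)

lemma half_line (g g' : ℝ → ℝ) (hg : Continuous g) (C C' : ℝ) (hC : ∀ t, |g t| ≤ C)
    (hd : ∀ t, 0 < t → HasDerivAt g (g' t) t) (hm : Measurable g') (hC' : ∀ t, |g' t| ≤ C') :
    ∫ t in Set.Ioi 0, (g t - g 0) ^ 2 * Real.exp (-t) ≤
      4 * ∫ t in Set.Ioi 0, g' t ^ 2 * Real.exp (-t) := by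
  have hexp : IntegrableOn (fun t : ℝ => Real.exp (-t)) (Set.Ioi 0) := integrableOn_exp_neg_Ioi 0
  have hCn : 0 ≤ C := (abs_nonneg _).trans (hC 0)
  have hC'n : 0 ≤ C' := (abs_nonneg _).trans (hC' 0)
  have hb : ∀ t, |g t - g 0| ≤ 2 * C := fun t => by
    have := abs_sub (g t) (g 0); have := hC t; have := hC 0; linarith
  have i1 : IntegrableOn (fun t => (g t - g 0) ^ 2 * Real.exp (-t)) (Set.Ioi 0) := by
    refine Integrable.bdd_mul (c := (2 * C) ^ 2) hexp ?_ ?_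
    · exact Continuous.aestronglyMeasurable (by fun_prop)
    · filter_upwards with t
      rw [norm_pow, Real.norm_eq_abs]
      exact pow_le_pow_left₀ (abs_nonneg _) (hb t) 2
  have i2 : IntegrableOn (fun t => g' t ^ 2 * Real.exp (-t)) (Set.Ioi 0) := by
    refine Integrable.bdd_mul (c := C' ^ 2) hexp ?_ ?_
    · exact Measurable.aestronglyMeasurable (by fun_prop)
    · filter_upwards with t
      rw [norm_pow, Real.norm_eq_abs]
      exact pow_le_pow_left₀ (abs_nonneg _) (hC' t) 2
  have i3 : IntegrableOn (fun t => (2 * (g t - g 0) * g' t) * Real.exp (-t)) (Set.Ioi 0) := by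
    refine Integrable.bdd_mul (c := 2 * (2 * C) * C') hexp ?_ ?_
    · exact Measurable.aestronglyMeasurable (by have := hg.measurable; fun_prop)
    · filter_upwards with t
      rw [Real.norm_eq_abs, abs_mul, abs_mul, abs_two]
      have := hb t; have := hC' t
      gcongr
  have key := integral_Ioi_of_hasDerivAt_of_tendsto (a := 0) (m := 0)
    (f := fun t => (g t - g 0) ^ 2 * Real.exp (-t))
    (f' := fun t => (2 * (g t - g 0) * g' t) * Real.exp (-t) - (g t - g 0) ^ 2 * Real.exp (-t))
    (Continuous.continuousWithinAt (by fun_prop))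
    (fun t ht => by
      have h1 := (((hd t ht).sub_const (g 0)).pow 2).mul
        ((hasDerivAt_id t).neg.exp)
      refine HasDerivAt.congr_deriv h1 ?_
      simp only [Pi.pow_apply, Pi.neg_apply, id]
      push_cast
      ring)
    (i3.sub i1)
    (by
      have h0 : Filter.Tendsto (fun t : ℝ => (2 * C) ^ 2 * Real.exp (-t)) Filter.atTop (nhds 0) := by
        have := (Real.tendsto_exp_neg_atTop_nhds_zero).const_mul ((2 * C) ^ 2)
        simpa using this
      refine squeeze_zero (fun t => by positivity) (fun t => ?_) h0
      gcongr ?_ * _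
      rw [← sq_abs]
      exact pow_le_pow_left₀ (abs_nonneg _) (hb t) 2)
  rw [integral_sub i3 i1] at key
  have h3 : ∫ t in Set.Ioi 0, (2 * (g t - g 0) * g' t) * Real.exp (-t) ≤
      ∫ t in Set.Ioi 0, ((1 / 2) * ((g t - g 0) ^ 2 * Real.exp (-t)) + 2 * (g' t ^ 2 * Real.exp (-t))) := by
    refine integral_mono i3 ((i1.const_mul _).add (i2.const_mul _)) fun t => ?_
    have : 0 < Real.exp (-t) := Real.exp_pos _
    have h := mul_nonneg this.le (sq_nonneg ((g t - g 0) - 2 * g' t))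
    dsimp only
    nlinarith
  rw [integral_add (i1.const_mul _) (i2.const_mul _), integral_const_mul, integral_const_mul] at h3
  simp only [sub_self] at key
  norm_num at key
  linarith

lemma integrable_exp_neg_abs' : Integrable (fun w : ℝ => (1 / 2) * Real.exp (-|w|)) := by
  refine Integrable.const_mul (.of_integral_ne_zero ?_) _
  rw [integral_comp_abs (f := fun x => Real.exp (-x)), integral_exp_neg_Ioi_zero]
  norm_num

instance : IsProbabilityMeasure laplaceMeasure := by
  constructor
  rw [laplaceMeasure, withDensity_apply _ MeasurableSet.univ, Measure.restrict_univ,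
    ← ofReal_integral_eq_lintegral_ofReal integrable_exp_neg_abs'
      (by filter_upwards with w; positivity), integral_const_mul,
    integral_comp_abs (f := fun x => Real.exp (-x)), integral_exp_neg_Ioi_zero]
  norm_num

lemma integral_laplace (f : ℝ → ℝ) (hf : Measurable f) (C : ℝ) (hC : ∀ t, |f t| ≤ C) :
    ∫ t, f t ∂laplaceMeasure = 1 / 2 * ((∫ t in Set.Ioi 0, f t * Real.exp (-t)) +
      ∫ t in Set.Ioi 0, f (-t) * Real.exp (-t)) := by
  have hi : Integrable (fun w : ℝ => f w * (1 / 2 * Real.exp (-|w|))) := by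
    refine Integrable.bdd_mul (c := C) integrable_exp_neg_abs' hf.aestronglyMeasurable ?_
    filter_upwards with t using hC t
  have h1 : ∫ t, f t ∂laplaceMeasure = ∫ w, f w * (1 / 2 * Real.exp (-|w|)) := by
    rw [laplaceMeasure, integral_withDensity_eq_integral_toReal_smul (by fun_prop)
      (by filter_upwards with w using ENNReal.ofReal_lt_top)]
    congr 1 with w
    rw [ENNReal.toReal_ofReal (by positivity), smul_eq_mul, mul_comm]
  rw [h1, ← intervalIntegral.integral_Iic_add_Ioi hi.integrableOn hi.integrableOn (b := 0)]
  have h2 := integral_comp_neg_Ioi 0 (fun w : ℝ => f w * (1 / 2 * Real.exp (-|w|)))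
  rw [neg_zero] at h2
  rw [← h2, mul_add, add_comm, ← integral_const_mul, ← integral_const_mul]
  congr 1
  · refine setIntegral_congr_fun measurableSet_Ioi fun t ht => ?_
    simp only [abs_of_pos (Set.mem_Ioi.1 ht)]; ring
  · refine setIntegral_congr_fun measurableSet_Ioi fun t ht => ?_
    simp only [abs_neg, abs_of_pos (Set.mem_Ioi.1 ht)]; ring

lemma integrable_of_bdd {α : Type*} [MeasurableSpace α] {μ : Measure α} [IsFiniteMeasure μ]
    {f : α → ℝ} (hf : Measurable f) {C : ℝ} (hC : ∀ t, |f t| ≤ C) : Integrable f μ :=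
  Integrable.of_bound hf.aestronglyMeasurable C (by filter_upwards with t using hC t)

lemma memLp_of_bdd {α : Type*} [MeasurableSpace α] {μ : Measure α} [IsFiniteMeasure μ]
    {f : α → ℝ} (hf : Measurable f) {C : ℝ} (hC : ∀ t, |f t| ≤ C) : MemLp f 2 μ :=
  MemLp.of_bound hf.aestronglyMeasurable C (by filter_upwards with t using hC t)

lemma sq_bdd {x C : ℝ} (h : |x| ≤ C) : |x ^ 2| ≤ C ^ 2 := by
  rw [abs_pow]; exact pow_le_pow_left₀ (abs_nonneg _) h 2

lemma laplace_poincare (g g' : ℝ → ℝ) (hg : Continuous g) (C C' : ℝ) (hC : ∀ t, |g t| ≤ C)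
    (hd : ∀ t, t ≠ 0 → HasDerivAt g (g' t) t) (hm : Measurable g') (hC' : ∀ t, |g' t| ≤ C') :
    variance g laplaceMeasure ≤ 4 * ∫ t, g' t ^ 2 ∂laplaceMeasure := by
  have hb : ∀ t, |g t - g 0| ≤ 2 * C := fun t => by
    have := abs_sub (g t) (g 0); have := hC t; have := hC 0; linarith
  have hgm := hg.measurable
  rw [← variance_sub_const hg.aestronglyMeasurable (g 0)]
  refine (variance_le_expectation_sq (Continuous.aestronglyMeasurable (by fun_prop))).trans ?_
  simp only [Pi.pow_apply]
  rw [integral_laplace _ (by fun_prop) _ (fun t => sq_bdd (hb t)),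
    integral_laplace _ (by fun_prop) _ (fun t => sq_bdd (hC' t))]
  have h1 := half_line g g' hg C C' hC (fun t ht => hd t ht.ne') hm hC'
  have h2 := half_line (fun t => g (-t)) (fun t => -g' (-t)) (by fun_prop) C C' (fun t => hC _)
    (fun t ht => by
      have := (hd (-t) (by linarith)).comp t (hasDerivAt_neg t)
      simpa [Function.comp_def] using this) (by fun_prop) (fun t => by simpa using hC' (-t))
  simp only [neg_zero, neg_sq] at h2
  linarith


lemma abs_integral_bdd {α : Type*} [MeasurableSpace α] {μ : Measure α} [IsProbabilityMeasure μ]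
    {f : α → ℝ} {C : ℝ} (hC : ∀ t, |f t| ≤ C) : |∫ x, f x ∂μ| ≤ C := by
  have := norm_integral_le_of_norm_le_const (μ := μ) (f := f) (C := C)
    (by filter_upwards with t using hC t)
  simpa using this

lemma es_two {α β : Type*} [MeasurableSpace α] [MeasurableSpace β] (μ : Measure α) (ν : Measure β)
    [IsProbabilityMeasure μ] [IsProbabilityMeasure ν] (f : α × β → ℝ) (hf : Measurable f)
    (C : ℝ) (hC : ∀ p, |f p| ≤ C) :
    variance f (μ.prod ν) ≤ ∫ y, variance (fun x => f (x, y)) μ ∂ν +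
      ∫ x, variance (fun y => f (x, y)) ν ∂μ := by
  have hx : ∀ x, Measurable (fun y => f (x, y)) := fun x => by fun_prop
  have hy : ∀ y, Measurable (fun x => f (x, y)) := fun x => by fun_prop
  set h : α → ℝ := fun x => ∫ y, f (x, y) ∂ν with hh
  set k : β → ℝ := fun y => ∫ x, f (x, y) ∂μ with hk
  have hhm : Measurable h := (hf.stronglyMeasurable.integral_prod_right' (ν := ν)).measurable
  have hkm : Measurable k := (hf.stronglyMeasurable.integral_prod_left' (μ := μ)).measurable
  have hhC : ∀ x, |h x| ≤ C := fun x => abs_integral_bdd fun y => hC _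
  have hkC : ∀ x, |k x| ≤ C := fun x => abs_integral_bdd fun y => hC _
  have if1 : Integrable f (μ.prod ν) := integrable_of_bdd hf hC
  have hf2m : Measurable (fun p => f p ^ 2) := by fun_prop
  have if2 : Integrable (fun p => f p ^ 2) (μ.prod ν) :=
    integrable_of_bdd hf2m fun p => sq_bdd (hC p)
  have hdm : Measurable (fun p : α × β => f p - k p.2) := by fun_prop
  have hdC : ∀ p : α × β, |f p - k p.2| ≤ 2 * C := fun p => by
    have := abs_sub (f p) (k p.2); have := hC p; have := hkC p.2; linarith
  have hd2 : Integrable (fun p : α × β => (f p - k p.2) ^ 2) (μ.prod ν) :=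
    integrable_of_bdd (by fun_prop) fun p => sq_bdd (hdC p)
  have e0 : variance f (μ.prod ν) = ∫ x, ∫ y, f (x, y) ^ 2 ∂ν ∂μ - (∫ x, h x ∂μ) ^ 2 := by
    rw [variance_eq_sub (memLp_of_bdd hf hC)]
    simp only [Pi.pow_apply]
    rw [integral_prod _ if2, integral_prod _ if1]
  have e1 : ∫ x, variance (fun y => f (x, y)) ν ∂μ =
      ∫ x, ∫ y, f (x, y) ^ 2 ∂ν ∂μ - ∫ x, h x ^ 2 ∂μ := by
    rw [← integral_sub if2.integral_prod_left
      (integrable_of_bdd (by fun_prop) fun p => sq_bdd (hhC p))]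
    congr 1 with x
    rw [variance_eq_sub (memLp_of_bdd (hx x) fun y => hC _)]
    rfl
  have e2 : ∫ y, variance (fun x => f (x, y)) μ ∂ν = ∫ x, ∫ y, (f (x, y) - k y) ^ 2 ∂ν ∂μ := by
    rw [integral_integral_swap hd2]
    congr 1 with y
    rw [variance_eq_integral (hy y).aemeasurable]
  have hm : ∫ y, k y ∂ν = ∫ x, h x ∂μ := (integral_integral_swap (f := fun x y => f (x, y)) if1).symm
  have e3 : ∫ x, h x ^ 2 ∂μ - (∫ x, h x ∂μ) ^ 2 ≤ ∫ x, ∫ y, (f (x, y) - k y) ^ 2 ∂ν ∂μ := by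
    have hv := variance_eq_sub (μ := μ) (memLp_of_bdd hhm hhC)
    simp only [Pi.pow_apply] at hv
    rw [← hv, variance_eq_integral hhm.aemeasurable]
    refine integral_mono (integrable_of_bdd (by fun_prop) (C := (2 * C) ^ 2) fun p => sq_bdd ?_)
      hd2.integral_prod_left fun x => ?_
    · have := abs_sub (h p) (∫ x, h x ∂μ); have := hhC p
      have := abs_integral_bdd (μ := μ) hhC; linarith
    · have hv2 := variance_nonneg (fun y => f (x, y) - k y) ν
      rw [variance_eq_sub (memLp_of_bdd (f := fun y => f (x, y) - k y) (by fun_prop) fun y => hdC (x, y))] at hv2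
      simp only [Pi.pow_apply] at hv2
      rw [integral_sub (integrable_of_bdd (hx x) fun y => hC _) (integrable_of_bdd hkm hkC), hm] at hv2
      dsimp only
      linarith
  linarith

lemma efron_stein (μ : Measure ℝ) [IsProbabilityMeasure μ] : ∀ (n : ℕ) (f : (Fin n → ℝ) → ℝ)
    (_ : Measurable f) (C : ℝ) (_ : ∀ w, |f w| ≤ C),
    variance f (Measure.pi fun _ : Fin n => μ) ≤
      ∑ i, ∫ w, variance (fun t => f (Function.update w i t)) μ ∂(Measure.pi fun _ : Fin n => μ) := by
  intro n
  induction n with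
  | zero =>
    intro f hf C hC
    have : f = fun _ => f 0 := by ext x; congr 1; exact Subsingleton.elim _ _
    rw [this, variance_eq_integral (by fun_prop)]
    simp
  | succ n ih =>
    intro f hf C hC
    have mp := (measurePreserving_piFinSuccAbove (fun _ : Fin (n+1) => μ) 0).symm
    set e := (MeasurableEquiv.piFinSuccAbove (fun _ : Fin (n+1) => ℝ) 0).symm with he
    have hee : ∀ t w, e (t, w) = Fin.cons t w := fun t w => by
      simp [he, MeasurableEquiv.piFinSuccAbove]; rfl
    set P := (Measure.pi fun _ : Fin n => μ) with hP
    have hfe : Measurable (fun p => f (e p)) := hf.comp e.measurable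
    rw [← mp.variance_fun_comp hf.aemeasurable]
    refine (es_two μ P (fun p => f (e p)) hfe C fun p => hC _).trans ?_
    have hmv : ∀ i, Measurable (fun w => variance (fun t => f (Function.update w i t)) μ) := by
      intro i
      have hu : Measurable (fun p : (Fin (n+1) → ℝ) × ℝ => f (Function.update p.1 i p.2)) := by
        refine hf.comp ?_
        refine measurable_pi_lambda _ fun j => ?_
        by_cases hj : j = i
        · subst hj; simpa using measurable_snd
        · simp only [Function.update_of_ne hj]; fun_prop
      have : (fun w => variance (fun t => f (Function.update w i t)) μ) =
          fun w => (∫ t, f (Function.update w i t) ^ 2 ∂μ) - (∫ t, f (Function.update w i t) ∂μ) ^ 2 := by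
        ext w
        rw [variance_eq_sub (memLp_of_bdd (f := fun t => f (Function.update w i t))
          (hf.comp (measurable_update w)) fun t => hC _)]
        rfl
      rw [this]
      have h2 : Measurable (fun p : (Fin (n+1) → ℝ) × ℝ => f (Function.update p.1 i p.2) ^ 2) := by
        fun_prop
      exact (h2.stronglyMeasurable.integral_prod_right').measurable.sub
        ((hu.stronglyMeasurable.integral_prod_right').measurable.pow_const 2)
    have hvC : ∀ i w, |variance (fun t => f (Function.update w i t)) μ| ≤ C ^ 2 := by
      intro i w
      have hu : Measurable (fun t => f (Function.update w i t)) := hf.comp (measurable_update w)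
      rw [abs_of_nonneg (variance_nonneg _ _)]
      refine (variance_le_expectation_sq hu.aestronglyMeasurable).trans ?_
      exact (le_abs_self _).trans (abs_integral_bdd fun t => sq_bdd (hC _))
    have hint : ∀ i, Integrable (fun p => variance (fun t => f (Function.update (e p) i t)) μ) (μ.prod P) :=
      fun i => integrable_of_bdd ((hmv i).comp e.measurable) fun p => hvC i _
    have hsw : ∀ i, ∫ w, variance (fun t => f (Function.update w i t)) μ ∂(Measure.pi fun _ : Fin (n+1) => μ)
        = ∫ x, ∫ w, variance (fun t => f (Function.update (e (x, w)) i t)) μ ∂P ∂μ := by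
      intro i
      rw [← integral_prod _ (hint i)]
      exact (mp.integral_comp e.measurableEmbedding _).symm
    rw [Fin.sum_univ_succ]
    simp only [hsw]
    refine add_le_add (le_of_eq ?_) ?_
    · simp only [hee, Fin.update_cons_zero]
      simp
    · simp only [hee]
      rw [← integral_finsetSum]
      swap
      · intro i _
        have := (hint i.succ).integral_prod_left
        simpa only [hee] using this
      have hcons : ∀ t, Measurable (fun w : Fin n → ℝ => f (Fin.cons t w)) := fun t => by
        simpa only [hee, Function.comp_def] using hfe.comp (measurable_prodMk_left (x := t))
      refine integral_mono_of_nonneg ?_ ?_ ?_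
      · filter_upwards with t using variance_nonneg _ _
      · refine integrable_finsetSum _ fun i _ => ?_
        have := (hint i.succ).integral_prod_left
        simpa only [hee] using this
      · filter_upwards with t
        refine (ih _ (hcons t) C fun w => hC _).trans (le_of_eq ?_)
        simp only [Fin.cons_update]


lemma lint_ftc (F f' : ℝ → ℝ) (a m : ℝ) (hd : ∀ x ∈ Set.Ici a, HasDerivAt F (f' x) x)
    (hp : ∀ x ∈ Set.Ioi a, 0 ≤ f' x) (hl : Filter.Tendsto F Filter.atTop (nhds m)) :
    ∫⁻ x in Set.Ioi a, ENNReal.ofReal (f' x) = ENNReal.ofReal (m - F a) := by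
  rw [← integral_Ioi_of_hasDerivAt_of_nonneg' hd hp hl,
    ofReal_integral_eq_lintegral_ofReal (integrableOn_Ioi_deriv_of_nonneg' hd hp hl)]
  filter_upwards [self_mem_ae_restrict measurableSet_Ioi] with x hx using hp x hx

lemma lint_exp (r : ℝ) (hr : 0 < r) :
    ∫⁻ a in Set.Ioi (1 : ℝ), ENNReal.ofReal ((a - 1) * Real.exp (-(a * r))) =
      ENNReal.ofReal (r⁻¹ ^ 2 * Real.exp (-r)) := by
  rw [lint_ftc (fun a => -(((a - 1) * r⁻¹ + r⁻¹ ^ 2) * Real.exp (-(a * r)))) _ 1 0]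
  · congr 1; simp
  · intro x _
    have h1 : HasDerivAt (fun a : ℝ => (a - 1) * r⁻¹ + r⁻¹ ^ 2) r⁻¹ x := by
      simpa using (((hasDerivAt_id x).sub_const 1).mul_const r⁻¹).add_const (r⁻¹ ^ 2)
    have h2 : HasDerivAt (fun a : ℝ => Real.exp (-(a * r))) (Real.exp (-(x * r)) * (-r)) x := by
      have := ((hasDerivAt_id x).mul_const r).neg.exp
      simpa using this
    refine (h1.mul h2).neg.congr_deriv ?_
    field_simp
    ring
  · intro x hx
    have : 0 ≤ x - 1 := by have := Set.mem_Ioi.1 hx; linarith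
    positivity
  · have hs : Filter.Tendsto (fun a : ℝ => a * r) Filter.atTop Filter.atTop :=
      Filter.tendsto_id.atTop_mul_const hr
    have h1 := (Real.tendsto_pow_mul_exp_neg_atTop_nhds_zero 1).comp hs
    have h0 := (Real.tendsto_pow_mul_exp_neg_atTop_nhds_zero 0).comp hs
    have := (h1.const_mul (-(r⁻¹ ^ 2))).add (h0.const_mul (r⁻¹ - r⁻¹ ^ 2))
    simp only [mul_zero, add_zero] at this
    refine this.congr fun a => ?_
    simp only [Function.comp]
    field_simp
    ring

lemma lint_pow (n : ℕ) :
    ∫⁻ a in Set.Ioi (1 : ℝ), ENNReal.ofReal ((a - 1) * (a ^ (n + 3))⁻¹) =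
      ENNReal.ofReal (1 / (((n : ℝ) + 2) * ((n : ℝ) + 1))) := by
  rw [lint_ftc (fun a => (a ^ (n + 2))⁻¹ / ((n : ℝ) + 2) - (a ^ (n + 1))⁻¹ / ((n : ℝ) + 1)) _ 1 0]
  · congr 1
    have : (n : ℝ) + 2 ≠ 0 := by positivity
    have : (n : ℝ) + 1 ≠ 0 := by positivity
    simp
    field_simp
    ring
  · intro x hx
    have hx0 : x ≠ 0 := by have := Set.mem_Ici.1 hx; linarith
    have h1 := ((hasDerivAt_pow (n + 2) x).inv (pow_ne_zero _ hx0)).div_const ((n : ℝ) + 2)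
    have h2 := ((hasDerivAt_pow (n + 1) x).inv (pow_ne_zero _ hx0)).div_const ((n : ℝ) + 1)
    refine (h1.sub h2).congr_deriv ?_
    have : (n : ℝ) + 2 ≠ 0 := by positivity
    have : (n : ℝ) + 1 ≠ 0 := by positivity
    push_cast
    field_simp
    ring
  · intro x hx
    have : 0 ≤ x - 1 := by have := Set.mem_Ioi.1 hx; linarith
    have : 0 < x := by linarith
    positivity
  · have h (k : ℕ) : Filter.Tendsto (fun a : ℝ => (a ^ (k + 1))⁻¹) Filter.atTop (nhds 0) :=
      (Filter.tendsto_pow_atTop (Nat.succ_ne_zero k)).inv_tendsto_atTop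
    simpa using ((h (n + 1)).div_const ((n : ℝ) + 2)).sub ((h n).div_const ((n : ℝ) + 1))

lemma lint_cons (μ : Measure ℝ) [SigmaFinite μ] {n : ℕ} (i : Fin (n + 1))
    (f : (Fin (n + 1) → ℝ) → ENNReal)
    (hf : Measurable f) : ∫⁻ w, f w ∂(Measure.pi fun _ : Fin (n + 1) => μ) =
      ∫⁻ t, ∫⁻ w, f (Fin.insertNth (α := fun _ => ℝ) i t w) ∂(Measure.pi fun _ : Fin n => μ) ∂μ := by
  have mp := (measurePreserving_piFinSuccAbove (fun _ : Fin (n+1) => μ) i).symm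
  rw [← mp.lintegral_comp hf, lintegral_prod]
  · rfl
  · exact (hf.comp (MeasurableEquiv.measurable _)).aemeasurable

lemma resample (μ : Measure ℝ) [IsProbabilityMeasure μ] {d : ℕ} (i : Fin d)
    (f : (Fin d → ℝ) → ENNReal) (hf : Measurable f) :
    ∫⁻ w, ∫⁻ t, f (Function.update w i t) ∂μ ∂(Measure.pi fun _ : Fin d => μ) =
      ∫⁻ w, f w ∂(Measure.pi fun _ : Fin d => μ) := by
  obtain ⟨n, rfl⟩ : ∃ n, d = n + 1 := ⟨d - 1, by have := i.pos; omega⟩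
  have hu : Measurable (fun p : (Fin (n+1) → ℝ) × ℝ => f (Function.update p.1 i p.2)) := by
    refine hf.comp ?_
    refine measurable_pi_lambda _ fun j => ?_
    by_cases hj : j = i
    · subst hj; simpa using measurable_snd
    · simp only [Function.update_of_ne hj]; fun_prop
  rw [lint_cons μ i _ hu.lintegral_prod_right', lint_cons μ i f hf]
  simp only [Fin.update_insertNth]
  rw [lintegral_const, measure_univ, mul_one, lintegral_lintegral_swap]
  have : Measurable (fun p : (Fin n → ℝ) × ℝ => f (Fin.insertNth (α := fun _ => ℝ) i p.2 p.1)) := by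
    have h := (hf.comp (MeasurableEquiv.measurable
      (MeasurableEquiv.piFinSuccAbove (fun _ : Fin (n+1) => ℝ) i).symm)).comp measurable_swap
    exact h
  exact this.aemeasurable

lemma lint_pi (n : ℕ) : ∀ (f : (Fin n → ℝ) → ENNReal) (_ : Measurable f),
    ∫⁻ w, f w ∂(Measure.pi fun _ : Fin n => laplaceMeasure) =
      ∫⁻ w, f w * ∏ i, ENNReal.ofReal ((1 / 2) * Real.exp (-|w i|)) := by
  induction n with
  | zero =>
    intro f hf
    simp [volume_pi]
    congr 1
    rw [Measure.pi_of_empty, Measure.pi_of_empty]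
  | succ n ih =>
    intro f hf
    have hin : Measurable (fun p : ℝ × (Fin n → ℝ) => f (Fin.insertNth (α := fun _ => ℝ) 0 p.1 p.2)) :=
      hf.comp (MeasurableEquiv.measurable
        (MeasurableEquiv.piFinSuccAbove (fun _ : Fin (n+1) => ℝ) 0).symm)
    rw [lint_cons _ 0 _ hf, volume_pi, lint_cons _ 0 _ (by fun_prop)]
    have h1 : ∀ t, ∫⁻ w, f (Fin.insertNth (α := fun _ => ℝ) 0 t w) ∂(Measure.pi fun _ : Fin n => laplaceMeasure) = _ :=
      fun t => ih _ (hin.comp measurable_prodMk_left)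
    simp only [h1]
    rw [laplaceMeasure, lintegral_withDensity_eq_lintegral_mul _ (by fun_prop)]
    · congr 1 with t
      simp only [Pi.mul_apply]
      rw [← lintegral_const_mul]
      · rw [volume_pi]
        congr 1 with w
        rw [Fin.prod_univ_succ]
        simp
        ring
      · refine Measurable.mul (hin.comp measurable_prodMk_left) (by fun_prop)
    · refine Measurable.lintegral_prod_right' (f := fun p : ℝ × (Fin n → ℝ) => f (Fin.insertNth (α := fun _ => ℝ) 0 p.1 p.2) * ∏ i, ENNReal.ofReal (1 / 2 * Real.exp (-|p.2 i|))) ?_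
      exact hin.mul (by fun_prop)

noncomputable def l1r {d : ℕ} (w : Fin d → ℝ) : ℝ := ∑ i, |w i|

lemma lint_pi' (n : ℕ) (f : (Fin n → ℝ) → ENNReal) (hf : Measurable f) :
    ∫⁻ w, f w ∂(Measure.pi fun _ : Fin n => laplaceMeasure) =
      ∫⁻ w, f w * ENNReal.ofReal ((1 / 2) ^ n * Real.exp (-l1r w)) := by
  rw [lint_pi n f hf]
  congr 1 with w
  rw [← ENNReal.ofReal_prod_of_nonneg (fun i _ => by positivity), Finset.prod_mul_distrib,
    ← Real.exp_sum, l1r]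
  simp

lemma l1r_meas {d : ℕ} : Measurable (l1r (d := d)) := by unfold l1r; fun_prop

lemma l1r_smul {d : ℕ} (c : ℝ) (hc : 0 < c) (w : Fin d → ℝ) : l1r (c • w) = c * l1r w := by
  simp [l1r, abs_mul, abs_of_pos hc, Finset.mul_sum]

lemma l1r_pos {d : ℕ} {w : Fin d → ℝ} (i : Fin d) (hw : w i ≠ 0) : 0 < l1r w :=
  Finset.sum_pos' (fun _ _ => abs_nonneg _) ⟨i, Finset.mem_univ _, abs_pos.2 hw⟩

lemma lint_scale {d : ℕ} (f : (Fin d → ℝ) → ENNReal) (hf : Measurable f) (a : ℝ) (ha : 0 < a) :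
    ∫⁻ w, f (a • w) = ENNReal.ofReal ((a ^ d)⁻¹) * ∫⁻ w, f w := by
  have h := Measure.map_addHaar_smul (volume : Measure (Fin d → ℝ)) ha.ne'
  rw [← lintegral_map (f := f) (g := fun w => a • w) hf (by fun_prop)]
  rw [h, lintegral_smul_measure]
  simp [abs_of_pos ha]

lemma ae_ne_zero {d : ℕ} : ∀ᵐ w : Fin d → ℝ ∂(Measure.pi fun _ : Fin d => laplaceMeasure),
    ∀ i, w i ≠ 0 := by
  rw [ae_all_iff]
  intro i
  have h0 : ∀ᵐ t ∂laplaceMeasure, t ≠ 0 := by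
    have : laplaceMeasure ≪ volume := withDensity_absolutelyContinuous _ _
    exact this.ae_le (Measure.ae_ne volume 0)
  exact (Measure.quasiMeasurePreserving_eval (fun _ : Fin d => laplaceMeasure) i).ae h0

lemma radial (n : ℕ) (H : (Fin (n + 3) → ℝ) → ENNReal) (hH : Measurable H) :
    ∫⁻ w, ENNReal.ofReal ((l1r w)⁻¹ ^ 2) * H ((l1r w)⁻¹ • w)
        ∂(Measure.pi fun _ : Fin (n + 3) => laplaceMeasure) =
      ENNReal.ofReal (1 / (((n : ℝ) + 2) * ((n : ℝ) + 1))) *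
        ∫⁻ w, H ((l1r w)⁻¹ • w) ∂(Measure.pi fun _ : Fin (n + 3) => laplaceMeasure) := by
  have hr := l1r_meas (d := n + 3)
  set K : (Fin (n + 3) → ℝ) → ENNReal := fun w => H ((l1r w)⁻¹ • w) with hK
  have hKm : Measurable K := hH.comp (hr.inv.smul measurable_id)
  have hKs : ∀ a : ℝ, 0 < a → ∀ w, K (a • w) = K w := by
    intro a ha w
    simp only [hK, l1r_smul a ha, smul_smul]
    congr 2
    field_simp
  set E : (Fin (n + 3) → ℝ) → ℝ → ENNReal := fun w a =>
    ENNReal.ofReal (a - 1) * (K w * ENNReal.ofReal ((1 / 2) ^ (n + 3) * Real.exp (-(a * l1r w)))) with hE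
  have hEm : Measurable (Function.uncurry E) := by
    simp only [hE, Function.uncurry_def]
    fun_prop
  rw [lint_pi' _ _ (by fun_prop), lint_pi' _ _ hKm]
  have h1 : ∀ᵐ w : Fin (n + 3) → ℝ, ENNReal.ofReal ((l1r w)⁻¹ ^ 2) * K w *
      ENNReal.ofReal ((1 / 2) ^ (n + 3) * Real.exp (-l1r w)) =
      ∫⁻ a in Set.Ioi (1 : ℝ), E w a := by
    have hz : ∀ᵐ w : Fin (n + 3) → ℝ, w 0 ≠ 0 :=
      (Measure.quasiMeasurePreserving_eval (fun _ : Fin (n + 3) => (volume : Measure ℝ)) 0).ae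
        (Measure.ae_ne volume 0)
    filter_upwards [hz] with w hw
    have hp := l1r_pos 0 hw
    have : ∫⁻ a in Set.Ioi (1 : ℝ), E w a = (K w * ENNReal.ofReal ((1 / 2) ^ (n + 3))) *
        ∫⁻ a in Set.Ioi (1 : ℝ), ENNReal.ofReal ((a - 1) * Real.exp (-(a * l1r w))) := by
      rw [← lintegral_const_mul _ (by fun_prop)]
      refine setLIntegral_congr_fun measurableSet_Ioi fun a ha => ?_
      have : 0 ≤ a - 1 := by have := Set.mem_Ioi.1 ha; linarith
      simp only [hE]
      rw [ENNReal.ofReal_mul (by positivity), ENNReal.ofReal_mul this]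
      ring
    rw [this, lint_exp _ hp, ENNReal.ofReal_mul (by positivity), ENNReal.ofReal_mul (by positivity)]
    ring
  rw [lintegral_congr_ae h1, lintegral_lintegral_swap hEm.aemeasurable]
  rw [← lint_pow, ← lintegral_mul_const _ (by fun_prop)]
  refine setLIntegral_congr_fun measurableSet_Ioi fun a ha => ?_
  have ha1 : 0 ≤ a - 1 := by have := Set.mem_Ioi.1 ha; linarith
  have ha0 : 0 < a := by linarith
  have h2 := lint_scale (fun w => K w * ENNReal.ofReal ((1 / 2) ^ (n + 3) * Real.exp (-l1r w)))
    (by fun_prop) a ha0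
  simp only [hKs a ha0, l1r_smul a ha0] at h2
  simp only [hE]
  rw [lintegral_const_mul _ (by fun_prop), h2, ENNReal.ofReal_mul ha1, mul_assoc]

lemma vec_bound {d : ℕ} (g z s : Fin d → ℝ) (m : ℝ) (hm : ∑ i, z i * g i = m)
    (hs : ∑ i, s i ^ 2 = d) (hz : ∑ i, s i * z i = 1) :
    ∑ i, (g i - s i * m) ^ 2 ≤ d * (∑ i, z i ^ 2) * ∑ i, g i ^ 2 := by
  set A := ∑ i, g i ^ 2 with hA
  set Z := ∑ i, z i ^ 2 with hZ
  set U := ∑ i, (g i - s i * m) ^ 2 with hU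
  set B := ∑ i, s i * g i with hB
  have hU' : U = A - 2 * m * B + d * m ^ 2 := by
    rw [hU, hA, hB, ← hs, Finset.mul_sum, Finset.sum_mul, ← Finset.sum_sub_distrib,
      ← Finset.sum_add_distrib]
    exact Finset.sum_congr rfl fun i _ => by ring
  set p := B - m * d with hp
  have hcs := Finset.sum_mul_sq_le_sq_mul_sq Finset.univ (fun i => g i - s i * m)
    (fun i => Z * s i - z i)
  have h1 : ∑ i, (g i - s i * m) * (Z * s i - z i) = Z * p := by
    have : ∀ i, (g i - s i * m) * (Z * s i - z i) =
        Z * (s i * g i) - z i * g i - m * Z * s i ^ 2 + m * (s i * z i) := fun i => by ring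
    simp only [this, Finset.sum_add_distrib, Finset.sum_sub_distrib, ← Finset.mul_sum]
    rw [hm, hs, hz, hp]; ring
  have h2 : ∑ i, (Z * s i - z i) ^ 2 = Z * (Z * d - 1) := by
    have : ∀ i, (Z * s i - z i) ^ 2 =
        Z ^ 2 * s i ^ 2 - 2 * Z * (s i * z i) + z i ^ 2 := fun i => by ring
    simp only [this, Finset.sum_add_distrib, Finset.sum_sub_distrib, ← Finset.mul_sum]
    rw [hs, hz]; ring
  rw [h1, h2] at hcs
  have hZ0 : 0 < Z := by
    rcases (Finset.sum_nonneg fun i _ => sq_nonneg (z i) : 0 ≤ Z).lt_or_eq with h | h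
    · exact h
    · exfalso
      have hz0 := (Finset.sum_eq_zero_iff_of_nonneg fun i _ => sq_nonneg (z i)).1 h.symm
      have : ∑ i, s i * z i = 0 := Finset.sum_eq_zero fun i hi => by
        have := pow_eq_zero_iff (two_ne_zero) |>.1 (hz0 i hi); simp [this]
      linarith
  have h3 : Z * p ^ 2 ≤ U * (Z * d - 1) := by
    refine le_of_mul_le_mul_left ?_ hZ0
    calc Z * (Z * p ^ 2) = (Z * p) ^ 2 := by ring
      _ ≤ _ := hcs
      _ = _ := by ring
  have h4 : d * A = d * U - p ^ 2 + B ^ 2 := by rw [hU', hp]; ring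
  have h5 : d * Z * A = Z * (d * U) - Z * p ^ 2 + Z * B ^ 2 := by
    calc d * Z * A = Z * (d * A) := by ring
      _ = _ := by rw [h4]; ring
  have : 0 ≤ Z * B ^ 2 := by positivity
  nlinarith

lemma num_bound (d Z A : ℝ) (hd : 3 ≤ d) (hZ : 0 ≤ Z) (hZ1 : Z ≤ 1) (hA : 0 ≤ A) :
    d * Z * A ≤ (d - 1) / d * (A * (1 + Real.sqrt d * Real.sqrt Z) ^ 2) := by
  set t := Real.sqrt d * Real.sqrt Z with ht
  have ht0 : 0 ≤ t := by positivity
  have ht2 : t ^ 2 = d * Z := by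
    rw [ht, mul_pow, Real.sq_sqrt (by linarith), Real.sq_sqrt hZ]
  have htd : t ^ 2 ≤ d := by rw [ht2]; nlinarith
  rw [← ht2]
  have h : d * t ^ 2 ≤ (d - 1) * (1 + t) ^ 2 := by
    rcases le_total t 1 with h | h <;> nlinarith
  have hd0 : 0 < d := by linarith
  rw [div_mul_eq_mul_div, le_div_iff₀ hd0]
  nlinarith [mul_le_mul_of_nonneg_right h hA]

section
variable {d : ℕ}

noncomputable def zt (w : Fin d → ℝ) : Fin d → ℝ := (l1r w)⁻¹ • w

noncomputable def Dd (G : (Fin d → ℝ) → ℝ) (i : Fin d) (u : Fin d → ℝ) : ℝ :=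
  (l1r u)⁻¹ * (fderiv ℝ G (zt u) (Pi.single i 1) - (u i / |u i|) * fderiv ℝ G (zt u) (zt u))

lemma zt_meas : Measurable (zt (d := d)) := l1r_meas.inv.smul measurable_id

lemma l1r_nonneg (w : Fin d → ℝ) : 0 ≤ l1r w := Finset.sum_nonneg fun _ _ => abs_nonneg _

lemma le_l1r (w : Fin d → ℝ) (i : Fin d) : |w i| ≤ l1r w :=
  Finset.single_le_sum (f := fun i => |w i|) (fun _ _ => abs_nonneg _) (Finset.mem_univ i)

lemma zt_norm (w : Fin d → ℝ) : ‖zt w‖ ≤ 1 := by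
  rw [pi_norm_le_iff_of_nonneg zero_le_one]
  intro i
  simp only [zt, Pi.smul_apply, smul_eq_mul, Real.norm_eq_abs, abs_mul, abs_inv,
    abs_of_nonneg (l1r_nonneg w)]
  rw [inv_mul_eq_div]
  exact div_le_one_of_le₀ (le_l1r w i) (l1r_nonneg w)

lemma bdd_ball {E : Type*} [NormedAddCommGroup E] (f : (Fin d → ℝ) → E) (hf : Continuous f) :
    ∃ C, ∀ x, ‖x‖ ≤ 1 → ‖f x‖ ≤ C := by
  obtain ⟨C, hC⟩ := (isCompact_closedBall (0 : Fin d → ℝ) 1).exists_bound_of_continuousOn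
    hf.continuousOn
  exact ⟨C, fun x hx => hC x (by simpa using hx)⟩

lemma Dd_meas (G : (Fin d → ℝ) → ℝ) (hG : ContDiff ℝ 1 G) (i : Fin d) : Measurable (Dd G i) := by
  have hc : Continuous (fderiv ℝ G) := hG.continuous_fderiv one_ne_zero
  have h1 : Continuous (fun x => fderiv ℝ G x (Pi.single i 1)) := by fun_prop
  have h2 : Continuous (fun x => fderiv ℝ G x x) := by fun_prop
  have h1' := h1.measurable.comp (zt_meas (d := d))
  have h2' := h2.measurable.comp (zt_meas (d := d))
  have hi : Measurable (fun u : Fin d → ℝ => u i / |u i|) := by fun_prop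
  exact l1r_meas.inv.mul (h1'.sub (hi.mul h2'))

lemma l1r_update (w : Fin d → ℝ) (i : Fin d) (t : ℝ) :
    l1r (Function.update w i t) = |t| + ∑ j ∈ Finset.univ.erase i, |w j| := by
  rw [l1r, ← Finset.add_sum_erase _ _ (Finset.mem_univ i)]
  simp only [Function.update_self]
  congr 1
  exact Finset.sum_congr rfl fun j hj => by rw [Function.update_of_ne (Finset.ne_of_mem_erase hj)]

lemma section_deriv (G : (Fin d → ℝ) → ℝ) (hG : ContDiff ℝ 1 G) (w : Fin d → ℝ) (i : Fin d)
    (t : ℝ) (ht : t ≠ 0) :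
    HasDerivAt (fun t => G (zt (Function.update w i t))) (Dd G i (Function.update w i t)) t := by
  set u := Function.update w i t with hu
  have hui : u i = t := by simp [hu]
  have hr : 0 < l1r u := l1r_pos i (by rwa [hui])
  have h1 : HasDerivAt (fun t => Function.update w i t) (Pi.single i (1 : ℝ)) t :=
    hasDerivAt_update w i t
  have h2 : HasDerivAt (fun t => l1r (Function.update w i t)) (t / |t|) t := by
    simp only [l1r_update]
    refine ((hasDerivAt_abs ht).add_const _).congr_deriv ?_
    rcases lt_or_gt_of_ne ht with h | h
    · rw [abs_of_neg h, sign_neg h]; field_simp; simp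
    · rw [abs_of_pos h, sign_pos h]; field_simp; simp
  have h3 := (h2.inv hr.ne').smul h1
  have h4 := ((hG.differentiable one_ne_zero) (zt u)).hasFDerivAt.comp_hasDerivAt t h3
  refine h4.congr_deriv ?_
  rw [Dd, hui]
  simp only [← hu, map_add, map_smul, smul_eq_mul, Pi.inv_apply]
  have : fderiv ℝ G (zt u) (zt u) = (l1r u)⁻¹ * fderiv ℝ G (zt u) u := by
    conv_lhs => rw [show fderiv ℝ G (zt u) (zt u) = fderiv ℝ G (zt u) ((l1r u)⁻¹ • u) from rfl]
    rw [map_smul, smul_eq_mul]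
  rw [this]
  field_simp
  ring

lemma section_poincare (hd : 2 ≤ d) (G : (Fin d → ℝ) → ℝ) (hG : ContDiff ℝ 1 G) (w : Fin d → ℝ)
    (hw : ∀ i, w i ≠ 0) (i : Fin d) :
    ENNReal.ofReal (variance (fun t => G (zt (Function.update w i t))) laplaceMeasure) ≤
      4 * ∫⁻ t, ENNReal.ofReal (Dd G i (Function.update w i t) ^ 2) ∂laplaceMeasure := by
  have hc : Continuous (fderiv ℝ G) := hG.continuous_fderiv one_ne_zero
  obtain ⟨C, hC⟩ := bdd_ball G hG.continuous
  obtain ⟨M1, hM1⟩ := bdd_ball (fun x => fderiv ℝ G x (Pi.single i 1)) (by fun_prop)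
  obtain ⟨M2, hM2⟩ := bdd_ball (fun x => fderiv ℝ G x x) (by fun_prop)
  have : Nontrivial (Fin d) := Fin.nontrivial_iff_two_le.2 hd
  obtain ⟨j, hj⟩ := exists_ne i
  have hrj : ∀ t, |w j| ≤ l1r (Function.update w i t) := fun t => by
    have := le_l1r (Function.update w i t) j
    rwa [Function.update_of_ne hj] at this
  have hwj : 0 < |w j| := abs_pos.2 (hw j)
  have hM10 : 0 ≤ M1 := (norm_nonneg _).trans (hM1 0 (by simp))
  have hM20 : 0 ≤ M2 := (norm_nonneg _).trans (hM2 0 (by simp))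
  have hDm : Measurable (fun t => Dd G i (Function.update w i t)) :=
    (Dd_meas G hG i).comp (measurable_update w)
  have hDb : ∀ t, |Dd G i (Function.update w i t)| ≤ |w j|⁻¹ * (M1 + M2) := by
    intro t
    set u := Function.update w i t
    have hru : |w j| ≤ l1r u := hrj t
    rw [Dd, abs_mul, abs_inv, abs_of_nonneg (l1r_nonneg u)]
    have h1 := hM1 _ (zt_norm u)
    have h2 := hM2 _ (zt_norm u)
    rw [Real.norm_eq_abs] at h1 h2
    have h3 : abs (u i / |u i|) ≤ 1 := by rw [abs_div, abs_abs]; exact div_self_le_one _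
    have h4 : |u i / |u i| * fderiv ℝ G (zt u) (zt u)| ≤ M2 := by
      rw [abs_mul]; nlinarith [abs_nonneg (fderiv ℝ G (zt u) (zt u))]
    have h5 := abs_sub (fderiv ℝ G (zt u) (Pi.single i 1)) (u i / |u i| * fderiv ℝ G (zt u) (zt u))
    gcongr
    linarith
  have hcont : Continuous (fun t => G (zt (Function.update w i t))) := by
    refine hG.continuous.comp ?_
    have hu : Continuous (fun t => Function.update w i t) := continuous_const.update i continuous_id
    have hl : Continuous (fun t => l1r (Function.update w i t)) := by
      simp only [l1r_update]; fun_prop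
    exact (hl.inv₀ fun t => (hwj.trans_le (hrj t)).ne').smul hu
  have key := laplace_poincare _ _ hcont C _ (fun t => hC _ (zt_norm _))
    (fun t ht => section_deriv G hG w i t ht) hDm hDb
  rw [← ofReal_integral_eq_lintegral_ofReal
    (integrable_of_bdd (by fun_prop) fun t => sq_bdd (hDb t)) (by filter_upwards with t; positivity)]
  rw [show (4 : ENNReal) = ENNReal.ofReal 4 by simp, ← ENNReal.ofReal_mul (by norm_num)]
  exact ENNReal.ofReal_le_ofReal key

lemma pointwise (hd : 3 ≤ d) (G : (Fin d → ℝ) → ℝ) (w : Fin d → ℝ)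
    (hw : ∀ i, w i ≠ 0) :
    ∑ i, Dd G i w ^ 2 ≤ (l1r w)⁻¹ ^ 2 * (((d : ℝ) - 1) / d *
      ((∑ i, fderiv ℝ G (zt w) (Pi.single i 1) ^ 2) *
          (1 + Real.sqrt d * Real.sqrt (∑ i, zt w i ^ 2)) ^ 2)) := by
  have hr : 0 < l1r w := l1r_pos ⟨0, by omega⟩ (hw _)
  have hm : ∑ i, zt w i * fderiv ℝ G (zt w) (Pi.single i 1) = fderiv ℝ G (zt w) (zt w) := by
    have := LinearMap.pi_apply_eq_sum_univ (fderiv ℝ G (zt w)).toLinearMap (zt w)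
    simp only [ContinuousLinearMap.coe_coe, smul_eq_mul] at this
    rw [this]
    refine Finset.sum_congr rfl fun i _ => ?_
    congr 2
    ext j
    simp [Pi.single_apply, eq_comm]
  have hs : ∑ i, (w i / |w i|) ^ 2 = (d : ℝ) := by
    have : ∀ i, (w i / |w i|) ^ 2 = 1 := fun i => by
      rw [div_pow, sq_abs, div_self (pow_ne_zero _ (hw i))]
    simp [this]
  have hz : ∑ i, (w i / |w i|) * zt w i = 1 := by
    have : ∀ i, (w i / |w i|) * zt w i = (l1r w)⁻¹ * |w i| := fun i => by
      have := abs_ne_zero.2 (hw i)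
      simp only [zt, Pi.smul_apply, smul_eq_mul]
      field_simp
      rw [sq_abs]
    simp only [this, ← Finset.mul_sum]
    exact inv_mul_cancel₀ hr.ne'
  have hv := vec_bound (fun i => fderiv ℝ G (zt w) (Pi.single i 1)) (zt w) (fun i => w i / |w i|)
    _ hm hs hz
  have hZ1 : ∑ i, zt w i ^ 2 ≤ 1 := by
    calc ∑ i, zt w i ^ 2 ≤ ∑ i, (w i / |w i|) * zt w i := by
          refine Finset.sum_le_sum fun i _ => ?_
          have h1 : |zt w i| ≤ 1 := (norm_le_pi_norm (zt w) i).trans (zt_norm w)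
          have h2 : (w i / |w i|) * zt w i = |zt w i| := by
            simp only [zt, Pi.smul_apply, smul_eq_mul, abs_mul, abs_inv, abs_of_pos hr]
            have := abs_ne_zero.2 (hw i)
            field_simp
            rw [sq_abs]
          rw [h2, ← sq_abs]
          nlinarith [abs_nonneg (zt w i)]
      _ = 1 := hz
  have hn := num_bound d (∑ i, zt w i ^ 2) (∑ i, fderiv ℝ G (zt w) (Pi.single i 1) ^ 2)
    (by exact_mod_cast hd) (by positivity) hZ1 (by positivity)
  simp only [Dd, mul_pow, ← Finset.mul_sum]
  refine mul_le_mul_of_nonneg_left (hv.trans hn) (by positivity)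

end

lemma ofReal_integral_le {α : Type*} [MeasurableSpace α] (μ : Measure α) (f : α → ℝ)
    (hf : ∀ x, 0 ≤ f x) : ENNReal.ofReal (∫ x, f x ∂μ) ≤ ∫⁻ x, ENNReal.ofReal (f x) ∂μ := by
  by_cases h : Integrable f μ
  · rw [ofReal_integral_eq_lintegral_ofReal h (by filter_upwards with x using hf x)]
  · rw [integral_undef h]; simp

/-- (Weighted Poincaré-type inequality on the ℓ¹-sphere.) Let `d ≥ 3`, `G : ℝᵈ → ℝ`
continuously differentiable, and `ζ` uniform on the ℓ¹-sphere. Then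
`Var(G(ζ)) ≤ (4/(d(d-2))) E[‖∇G(ζ)‖₂² (1 + √d ‖ζ‖₂)²]`. -/
theorem weighted_poincare_l1_sphere (d : ℕ) (hd : 3 ≤ d)
    (G : (Fin d → ℝ) → ℝ) (hG : ContDiff ℝ 1 G) :
    variance G (sphereUniform d) ≤
      4 / ((d : ℝ) * ((d : ℝ) - 2)) *
        ∫ ζ, (∑ i, fderiv ℝ G ζ (Pi.single i 1) ^ 2) *
          (1 + Real.sqrt d * Real.sqrt (∑ i, ζ i ^ 2)) ^ 2 ∂sphereUniform d := by
  have hc : Continuous (fderiv ℝ G) := hG.continuous_fderiv one_ne_zero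
  set H : (Fin d → ℝ) → ℝ := fun ζ => (∑ i, fderiv ℝ G ζ (Pi.single i 1) ^ 2) *
          (1 + Real.sqrt d * Real.sqrt (∑ i, ζ i ^ 2)) ^ 2 with hH
  have hHc : Continuous H := by fun_prop
  have hH0 : ∀ x, 0 ≤ H x := fun x => by simp only [hH]; positivity
  set P := (Measure.pi fun _ : Fin d => laplaceMeasure) with hP
  have hsu : sphereUniform d = Measure.map zt P := rfl
  obtain ⟨C, hC⟩ := bdd_ball G hG.continuous
  obtain ⟨CH, hCH⟩ := bdd_ball H hHc
  have hHi : Integrable (fun w => H (zt w)) P :=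
    integrable_of_bdd (hHc.measurable.comp zt_meas) fun w => hCH _ (zt_norm w)
  have hint : ∫ ζ, H ζ ∂sphereUniform d = ∫ w, H (zt w) ∂P := by
    rw [hsu, integral_map zt_meas.aemeasurable hHc.aestronglyMeasurable]
  have hvar : variance G (sphereUniform d) = variance (fun w => G (zt w)) P := by
    rw [hsu, variance_map hG.continuous.aemeasurable zt_meas.aemeasurable]
    rfl
  rw [hint, hvar]
  have hd3 : (3 : ℝ) ≤ d := by exact_mod_cast hd
  have hI0 : 0 ≤ ∫ w, H (zt w) ∂P := integral_nonneg fun w => hH0 _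
  have hk0 : 0 ≤ 4 / ((d : ℝ) * ((d : ℝ) - 2)) :=
    div_nonneg (by norm_num) (mul_nonneg (by linarith) (by linarith))
  rw [← ENNReal.ofReal_le_ofReal_iff (mul_nonneg hk0 hI0)]
  have hDm := Dd_meas G hG
  calc ENNReal.ofReal (variance (fun w => G (zt w)) P)
      ≤ ENNReal.ofReal (∑ i, ∫ w, variance (fun t => G (zt (Function.update w i t))) laplaceMeasure ∂P) :=
        ENNReal.ofReal_le_ofReal (efron_stein laplaceMeasure d (fun w => G (zt w))
          (hG.continuous.measurable.comp zt_meas) C fun w => hC _ (zt_norm w))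
    _ = ∑ i, ENNReal.ofReal (∫ w, variance (fun t => G (zt (Function.update w i t))) laplaceMeasure ∂P) :=
        ENNReal.ofReal_sum_of_nonneg fun i _ => integral_nonneg fun w => variance_nonneg _ _
    _ ≤ ∑ i, 4 * ∫⁻ w, ENNReal.ofReal (Dd G i w ^ 2) ∂P := by
        refine Finset.sum_le_sum fun i _ => ?_
        refine (ofReal_integral_le _ _ fun w => variance_nonneg _ _).trans ?_
        rw [← resample laplaceMeasure i (fun w => ENNReal.ofReal (Dd G i w ^ 2)) (by fun_prop),
          ← lintegral_const_mul' _ _ (by norm_num)]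
        refine lintegral_mono_ae ?_
        filter_upwards [ae_ne_zero] with w hw
        exact section_poincare (by omega) G hG w hw i
    _ = 4 * ∫⁻ w, ENNReal.ofReal (∑ i, Dd G i w ^ 2) ∂P := by
        rw [← Finset.mul_sum, ← lintegral_finsetSum _ (fun i _ => by fun_prop)]
        congr 2 with w
        rw [ENNReal.ofReal_sum_of_nonneg fun i _ => sq_nonneg _]
    _ ≤ 4 * ∫⁻ w, ENNReal.ofReal (((d : ℝ) - 1) / d) *
          (ENNReal.ofReal ((l1r w)⁻¹ ^ 2) * ENNReal.ofReal (H (zt w))) ∂P := by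
        refine mul_le_mul_right (lintegral_mono_ae ?_) _
        filter_upwards [ae_ne_zero] with w hw
        have hpos : 0 ≤ ((d : ℝ) - 1) / d := div_nonneg (by linarith) (by linarith)
        rw [← ENNReal.ofReal_mul (by positivity), ← ENNReal.ofReal_mul hpos]
        refine ENNReal.ofReal_le_ofReal ((pointwise hd G w hw).trans (le_of_eq ?_))
        simp only [hH]; ring
    _ = ENNReal.ofReal (4 / ((d : ℝ) * ((d : ℝ) - 2)) * ∫ w, H (zt w) ∂P) := by
        rw [lintegral_const_mul' _ _ ENNReal.ofReal_ne_top]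
        obtain ⟨n, rfl⟩ : ∃ n, d = n + 3 := ⟨d - 3, by omega⟩
        have hrad := radial n (fun x => ENNReal.ofReal (H x)) (by fun_prop)
        have e : ∀ w : Fin (n + 3) → ℝ, (l1r w)⁻¹ • w = zt w := fun w => rfl
        simp only [e] at hrad
        rw [hrad, ← ofReal_integral_eq_lintegral_ofReal hHi (by filter_upwards with w using hH0 _)]
        rw [show (4 : ENNReal) = ENNReal.ofReal 4 by simp]
        have hpos : 0 ≤ (((n + 3 : ℕ) : ℝ) - 1) / ((n + 3 : ℕ) : ℝ) :=
          div_nonneg (by linarith) (by linarith)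
        rw [← ENNReal.ofReal_mul (by positivity), ← ENNReal.ofReal_mul hpos,
          ← ENNReal.ofReal_mul (by norm_num)]
        congr 1
        push_cast
        have : (n : ℝ) + 2 ≠ 0 := by positivity
        have : (n : ℝ) + 1 ≠ 0 := by positivity
        have : (n : ℝ) + 3 ≠ 0 := by positivity
        have h1 : (n : ℝ) + 3 - 1 = n + 2 := by ring
        have h2 : (n : ℝ) + 3 - 2 = n + 1 := by ring
        rw [h1, h2]
        field_simp
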